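/- Fix a finite set X. Let u be a CDM parameter on X, let C ⊆ X be a subset with |C| ≥ 2, and let x ∈ C. Define β_{x,C} = log P_u(x|C) − (1/|C|) Σ_{y∈C} log P_u(y|C). Then β_{x,C} = (1/|C|) Σ_{y∈C, y≠x} [ (u_{xy} − u_{yx}) + Σ_{z∈C, z∉{x,y}} (u_{xz} − u_{yz}) ]. -/

import Mathlib

/-- The CDM choice probability: `P_u(x|C) = exp(∑_{z∈C, z≠x} u x z) / ∑_{y∈C} exp(∑_{z∈C, z≠y} u y z)`. -/
noncomputable def cdmProb {α : Type*} [DecidableEq α] (u : α → α → ℝ) (C : Finset α) (x : α) : ℝ :=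
  Real.exp (∑ z ∈ C.erase x, u x z) / ∑ y ∈ C, Real.exp (∑ z ∈ C.erase y, u y z)

theorem log_cdmProb {α : Type*} [DecidableEq α] (u : α → α → ℝ) {C : Finset α}
    (hC : C.Nonempty) (x : α) :
    Real.log (cdmProb u C x) =
      ∑ z ∈ C.erase x, u x z - Real.log (∑ y ∈ C, Real.exp (∑ z ∈ C.erase y, u y z)) := by
  rw [cdmProb, Real.log_div (Real.exp_ne_zero _)
    (Finset.sum_pos (fun y _ => Real.exp_pos _) hC).ne', Real.log_exp]

theorem sum_erase_sub_sum_erase {α : Type*} [DecidableEq α] (u : α → α → ℝ) {C : Finset α}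
    {x y : α} (hx : x ∈ C) (hy : y ∈ C.erase x) :
    ∑ z ∈ C.erase x, u x z - ∑ z ∈ C.erase y, u y z =
      (u x y - u y x) + ∑ z ∈ (C.erase x).erase y, (u x z - u y z) := by
  have hxy : x ∈ C.erase y := Finset.mem_erase.2 ⟨(Finset.ne_of_mem_erase hy).symm, hx⟩
  rw [← Finset.add_sum_erase _ _ hy, ← Finset.add_sum_erase _ _ hxy,
    Finset.erase_right_comm (a := y), Finset.sum_sub_distrib]
  ring

/-- **Fact 3 of the paper.**  For a CDM parameter `u`, a choice set `C` with `|C| ≥ 2`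
and `x ∈ C`, the centered log choice probability
`β_{x,C} = log P_u(x|C) - (1/|C|) ∑_{y∈C} log P_u(y|C)` equals
`(1/|C|) ∑_{y∈C, y≠x} [ (u x y - u y x) + ∑_{z∈C, z∉{x,y}} (u x z - u y z) ]`. -/
theorem cdm_beta_formula {α : Type*} [Fintype α] [DecidableEq α]
    (u : α → α → ℝ) (C : Finset α) (hC : 2 ≤ C.card) (x : α) (hx : x ∈ C) :
    Real.log (cdmProb u C x) - (1 / (C.card : ℝ)) * ∑ y ∈ C, Real.log (cdmProb u C y) =
      (1 / (C.card : ℝ)) * ∑ y ∈ C.erase x,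
        ((u x y - u y x) + ∑ z ∈ (C.erase x).erase y, (u x z - u y z)) := by
  have hne : C.Nonempty := ⟨x, hx⟩
  have hcard : (C.card : ℝ) ≠ 0 := Nat.cast_ne_zero.2 hne.card_ne_zero
  rw [← Finset.sum_congr rfl fun y hy => sum_erase_sub_sum_erase u hx hy,
    Finset.sum_erase _ (sub_self _)]
  simp only [log_cdmProb u hne, Finset.sum_sub_distrib, Finset.sum_const, nsmul_eq_mul]
  field_simp
  ring
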